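/- For all positive integers ℓ_A, ℓ_B, the probability P(ℓ_A, ℓ_B) equals the double angular integral (1/π²) ∫_0^π ∫_0^π [sin θ₂ · sin(ℓ_B θ₂) / (1 − cos θ₂)] · [sin θ₁ · sin(ℓ_A θ₁) / ((1 − cos θ₁) + (1 − cos θ₂))] dθ₁ dθ₂. -/

import Mathlib

open MeasureTheory Real

/-- Modified Bessel function of the first kind, integer order, defined by its series. -/
noncomputable def besselI (n : ℕ) (x : ℝ) : ℝ :=
  ∑' m : ℕ, (x / 2) ^ (n + 2 * m) / ((m.factorial : ℝ) * ((n + m).factorial : ℝ))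

/-- Probability that walker `A` first reaches site `a` before walker `B` first reaches `b`. -/
noncomputable def Pfirst (a b : ℕ) : ℝ :=
  (a : ℝ) * (b : ℝ) * ∫ tA in Set.Ioi (0 : ℝ),
    (Real.exp (-tA) * besselI a tA / tA) *
      ∫ tB in Set.Ioi tA, Real.exp (-tB) * besselI b tB / tB

open Set in
/-- The Laplace transform over `(s, ∞)` of a mixture of exponentials, by Fubini. -/
lemma integral_Ioi_integral_mul_exp_neg {X : Type*} [MeasurableSpace X] {ν : Measure X}
    [IsFiniteMeasure ν] {g u : X → ℝ} (hg : Measurable g) (hu : Measurable u) {C : ℝ}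
    (hpos : ∀ᵐ x ∂ν, 0 < u x) (hC : ∀ᵐ x ∂ν, |g x| ≤ C * u x) {s : ℝ} (hs : 0 ≤ s) :
    ∫ t in Ioi s, ∫ x, g x * exp (-(t * u x)) ∂ν =
      ∫ x, g x / u x * exp (-(s * u x)) ∂ν := by
  have hexp : ∀ c > 0, IntegrableOn (fun t : ℝ => exp (-(t * c))) (Ioi s) := fun c hc => by
    simpa [mul_comm] using integrableOn_exp_mul_Ioi (neg_lt_zero.2 hc) s
  have hval : ∀ c > 0, ∫ t in Ioi s, exp (-(t * c)) = exp (-(s * c)) / c := fun c hc => by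
    have := integral_exp_mul_Ioi (neg_lt_zero.2 hc) s
    rw [neg_div_neg_eq] at this
    simpa [mul_comm] using this
  have hmeas : Measurable (Function.uncurry fun (t : ℝ) (x : X) => g x * exp (-(t * u x))) := by
    unfold Function.uncurry
    fun_prop
  rw [integral_integral_swap]
  · refine integral_congr_ae ?_
    filter_upwards [hpos] with x hx
    rw [integral_const_mul, hval _ hx]
    ring
  · rw [integrable_prod_iff' hmeas.aestronglyMeasurable]
    refine ⟨?_, ?_⟩
    · filter_upwards [hpos] with x hx
      exact (hexp _ hx).const_mul (g x)
    · have hb : Integrable (fun x => |g x| * (exp (-(s * u x)) / u x)) ν := by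
        refine Integrable.of_bound (by fun_prop) C ?_
        filter_upwards [hpos, hC] with x hx hgx
        rw [norm_mul, norm_of_nonneg (abs_nonneg _), norm_of_nonneg (by positivity),
          ← mul_div_assoc, div_le_iff₀ hx]
        refine (mul_le_of_le_one_right (abs_nonneg _) ?_).trans hgx
        exact exp_le_one_iff.2 (neg_nonpos.2 (mul_nonneg hs hx.le))
      refine hb.congr ?_
      filter_upwards [hpos] with x hx
      simp only [Function.uncurry_apply_pair, norm_mul, norm_eq_abs, abs_exp]
      rw [integral_const_mul, hval _ hx]

lemma HasSum.mul_of_summable_norm {ι κ : Type*} {f : ι → ℂ} {g : κ → ℂ} {a b : ℂ}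
    (hf : HasSum f a) (hg : HasSum g b) (hf' : Summable fun i => ‖f i‖)
    (hg' : Summable fun k => ‖g k‖) :
    HasSum (fun q : ι × κ => f q.1 * g q.2) (a * b) :=
  hf.mul hg (summable_mul_of_summable_norm hf' hg')

lemma Complex.hasSum_pow_div_factorial (z : ℂ) :
    HasSum (fun k : ℕ => z ^ k / (k.factorial : ℂ)) (Complex.exp z) := by
  rw [Complex.exp_eq_exp_ℂ]
  exact NormedSpace.expSeries_div_hasSum_exp z

lemma hasSum_pow_mul_pow_div_factorial (z w : ℂ) :
    HasSum (fun q : ℕ × ℕ => z ^ q.1 / (q.1.factorial : ℂ) * (w ^ q.2 / (q.2.factorial : ℂ)))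
      (Complex.exp (z + w)) := by
  have h := (Complex.hasSum_pow_div_factorial z).mul_of_summable_norm
    (Complex.hasSum_pow_div_factorial w) (NormedSpace.norm_expSeries_div_summable z)
    (NormedSpace.norm_expSeries_div_summable w)
  rw [← Complex.exp_add] at h
  exact h

lemma re_pow_mul_pow_mul_exp (n m p : ℕ) (x θ : ℝ) :
    (((x / 2 : ℝ) * Complex.exp (-(θ * Complex.I))) ^ m / (m.factorial : ℂ) *
      (((x / 2 : ℝ) * Complex.exp (θ * Complex.I)) ^ p / (p.factorial : ℂ)) *
        Complex.exp (-(n * θ * Complex.I))).re =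
      (x / 2) ^ (m + p) / (m.factorial * p.factorial) * cos ((p - m - n : ℝ) * θ) := by
  have hexp : (((p - m - n : ℝ) * θ : ℝ) * Complex.I : ℂ) =
      m * (-(θ * Complex.I)) + p * (θ * Complex.I) + -(n * θ * Complex.I) := by
    push_cast
    ring
  rw [← Complex.exp_ofReal_mul_I_re, ← Complex.re_ofReal_mul, hexp, Complex.exp_add,
    Complex.exp_add, mul_pow, mul_pow, ← Complex.exp_nat_mul, ← Complex.exp_nat_mul]
  congr 1
  push_cast
  ring

lemma hasSum_exp_mul_cos_mul_cos (n : ℕ) (x θ : ℝ) :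
    HasSum (fun q : ℕ × ℕ => (x / 2) ^ (q.1 + q.2) / (q.1.factorial * q.2.factorial) *
      cos ((q.2 - q.1 - n : ℝ) * θ)) (exp (x * cos θ) * cos (n * θ)) := by
  have hre := Complex.hasSum_re ((hasSum_pow_mul_pow_div_factorial
    ((x / 2 : ℝ) * Complex.exp (-(θ * Complex.I)))
    ((x / 2 : ℝ) * Complex.exp (θ * Complex.I))).mul_right (Complex.exp (-(n * θ * Complex.I))))
  have hadd : (x / 2 : ℝ) * Complex.exp (-(θ * Complex.I)) +
      (x / 2 : ℝ) * Complex.exp (θ * Complex.I) = ((x * cos θ : ℝ) : ℂ) := by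
    have := Complex.two_cos (θ : ℂ)
    rw [neg_mul] at this
    rw [← mul_add, add_comm, ← this]
    push_cast
    ring
  have hn : (-(n * θ * Complex.I) : ℂ) = ((-(n * θ) : ℝ) : ℂ) * Complex.I := by
    push_cast
    ring
  have hval : (Complex.exp ((x * cos θ : ℝ) : ℂ) * Complex.exp (-(n * θ * Complex.I))).re =
      exp (x * cos θ) * cos (n * θ) := by
    rw [← Complex.ofReal_exp, Complex.re_ofReal_mul, hn, Complex.exp_ofReal_mul_I_re, cos_neg]
  rw [hadd, hval] at hre
  exact hre.congr_fun fun q => (re_pow_mul_pow_mul_exp n q.1 q.2 x θ).symm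

lemma integral_cos_int_mul (k : ℤ) :
    ∫ θ in (0 : ℝ)..π, cos (k * θ) = if k = 0 then π else 0 := by
  split_ifs with hk
  · simp [hk]
  · rw [intervalIntegral.integral_comp_mul_left _ (Int.cast_ne_zero.2 hk)]
    simp [sin_int_mul_pi]

/-- Bessel's integral representation of the modified Bessel functions. -/
lemma integral_exp_mul_cos_mul_cos (n : ℕ) (x : ℝ) :
    ∫ θ in (0 : ℝ)..π, exp (x * cos θ) * cos (n * θ) = π * besselI n x := by
  have hs : Summable fun q : ℕ × ℕ => |x / 2| ^ (q.1 + q.2) / (q.1.factorial * q.2.factorial) := by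
    have h := Real.summable_pow_div_factorial |x / 2|
    refine (h.mul_of_nonneg h (fun k => by positivity) (fun k => by positivity)).congr fun q => ?_
    rw [pow_add, div_mul_div_comm]
  have h := intervalIntegral.hasSum_integral_of_dominated_convergence (μ := volume)
    (a := 0) (b := π)
    (F := fun (q : ℕ × ℕ) (θ : ℝ) => (x / 2) ^ (q.1 + q.2) / (q.1.factorial * q.2.factorial) *
      cos ((q.2 - q.1 - n : ℝ) * θ))
    (fun q _ => |x / 2| ^ (q.1 + q.2) / (q.1.factorial * q.2.factorial))
    (fun q => (by fun_prop : Continuous _).aestronglyMeasurable)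
    (fun q => ae_of_all _ fun θ _ => by
      rw [norm_mul, norm_div, norm_pow, norm_eq_abs, norm_of_nonneg (by positivity)]
      exact mul_le_of_le_one_right (by positivity) (abs_cos_le_one _))
    (ae_of_all _ fun _ _ => hs) intervalIntegrable_const
    (ae_of_all _ fun θ _ => hasSum_exp_mul_cos_mul_cos n x θ)
  have hinj : Function.Injective fun m : ℕ => (m, n + m) := fun _ _ h => (Prod.ext_iff.1 h).1
  have hint (q : ℕ × ℕ) : ∫ θ in (0 : ℝ)..π,
      (x / 2) ^ (q.1 + q.2) / (q.1.factorial * q.2.factorial) * cos ((q.2 - q.1 - n : ℝ) * θ) =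
      (x / 2) ^ (q.1 + q.2) / (q.1.factorial * q.2.factorial) *
        if q.2 = n + q.1 then π else 0 := by
    have := integral_cos_int_mul (q.2 - q.1 - n)
    push_cast at this
    rw [intervalIntegral.integral_const_mul, this]
    congr 2
    exact propext ⟨fun h => by omega, fun h => by omega⟩
  simp only [hint] at h
  rw [← hinj.hasSum_iff fun q hq => by
    rw [if_neg fun h => hq ⟨q.1, Prod.ext rfl h.symm⟩, mul_zero]] at h
  rw [← h.tsum_eq, besselI, ← tsum_mul_left]
  refine tsum_congr fun m => ?_
  simp only [Function.comp_apply, if_true]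
  rw [show m + (n + m) = n + 2 * m by ring]
  ring

lemma natCast_mul_exp_neg_mul_besselI_div (n : ℕ) {t : ℝ} (ht : t ≠ 0) :
    n * (exp (-t) * besselI n t / t) =
      π⁻¹ * ∫ θ in (0 : ℝ)..π, sin θ * sin (n * θ) * exp (-(t * (1 - cos θ))) := by
  have hparts := intervalIntegral.integral_mul_deriv_eq_deriv_mul (a := 0) (b := π)
    (u := fun θ => exp (t * cos θ)) (u' := fun θ => exp (t * cos θ) * (t * -sin θ))
    (v := fun θ => sin (n * θ)) (v' := fun θ => cos (n * θ) * n)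
    (fun θ _ => ((hasDerivAt_cos θ).const_mul t).exp)
    (fun θ _ => by simpa using ((hasDerivAt_id θ).const_mul (n : ℝ)).sin)
    ((by fun_prop : Continuous _).intervalIntegrable _ _)
    ((by fun_prop : Continuous _).intervalIntegrable _ _)
  simp only [sin_nat_mul_pi, mul_zero, sin_zero, sub_zero, zero_sub, ← mul_assoc,
    intervalIntegral.integral_mul_const, integral_exp_mul_cos_mul_cos] at hparts
  have hE : ∫ θ in (0 : ℝ)..π, sin θ * sin (n * θ) * exp (-(t * (1 - cos θ))) =
      exp (-t) * (π * besselI n t * n / t) := by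
    rw [hparts, ← intervalIntegral.integral_neg, ← intervalIntegral.integral_div,
      ← intervalIntegral.integral_const_mul]
    refine intervalIntegral.integral_congr fun θ _ => ?_
    rw [show -(t * (1 - cos θ)) = -t + t * cos θ by ring, exp_add]
    field_simp
  rw [hE]
  field_simp

lemma abs_sin_natCast_mul_le (n : ℕ) (θ : ℝ) : |sin (n * θ)| ≤ n * |sin θ| := by
  induction n with
  | zero => simp
  | succ n ih =>
    push_cast
    rw [add_one_mul, sin_add, add_one_mul]
    refine (abs_add_le _ _).trans (add_le_add ?_ ?_)
    · rw [abs_mul]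
      exact (mul_le_of_le_one_right (abs_nonneg _) (abs_cos_le_one _)).trans ih
    · rw [abs_mul]
      exact mul_le_of_le_one_left (abs_nonneg _) (abs_cos_le_one _)

lemma abs_sin_mul_sin_natCast_mul_le (n : ℕ) (θ : ℝ) :
    |sin θ * sin (n * θ)| ≤ 2 * n * (1 - cos θ) := by
  have h : |sin θ| * |sin θ| = (1 + cos θ) * (1 - cos θ) := by
    rw [abs_mul_abs_self]
    linarith [sin_sq_add_cos_sq θ]
  calc |sin θ * sin (n * θ)| ≤ |sin θ| * (n * |sin θ|) := by
        rw [abs_mul]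
        gcongr
        exact abs_sin_natCast_mul_le n θ
    _ = n * ((1 + cos θ) * (1 - cos θ)) := by rw [← h]; ring
    _ ≤ n * (2 * (1 - cos θ)) := by
        gcongr
        · linarith [cos_le_one θ]
        · linarith [cos_le_one θ]
    _ = 2 * n * (1 - cos θ) := by ring

lemma one_sub_cos_pos_of_mem_Ioc {θ : ℝ} (hθ : θ ∈ Set.Ioc 0 π) : 0 < 1 - cos θ := by
  have := cos_lt_cos_of_nonneg_of_le_pi le_rfl hθ.2 hθ.1
  rw [cos_zero] at this
  linarith


theorem Pfirst_eq_double_angular_integral (a b : ℕ) (ha : 1 ≤ a) (hb : 1 ≤ b) :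
    Pfirst a b = (1 / Real.pi ^ 2) * ∫ θ₂ in (0 : ℝ)..Real.pi,
      (Real.sin θ₂ * Real.sin (b * θ₂) / (1 - Real.cos θ₂)) *
        ∫ θ₁ in (0 : ℝ)..Real.pi,
          Real.sin θ₁ * Real.sin (a * θ₁) / ((1 - Real.cos θ₁) + (1 - Real.cos θ₂)) := by
  set ν : Measure ℝ := volume.restrict (Set.Ioc 0 π)
  have hpos : ∀ᵐ θ ∂ν, 0 < 1 - cos θ :=
    (ae_restrict_mem measurableSet_Ioc).mono fun θ hθ => one_sub_cos_pos_of_mem_Ioc hθ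
  have hπ : (0 : ℝ) ≤ π := pi_pos.le
  have hrep (n : ℕ) {t : ℝ} (ht : 0 < t) : n * (exp (-t) * besselI n t / t) =
      π⁻¹ * ∫ θ, sin θ * sin (n * θ) * exp (-(t * (1 - cos θ))) ∂ν := by
    rw [natCast_mul_exp_neg_mul_besselI_div n ht.ne', intervalIntegral.integral_of_le hπ]
  have htail {s : ℝ} (hs : 0 < s) :
      b * ∫ t in Set.Ioi s, exp (-t) * besselI b t / t = π⁻¹ *
        ∫ θ, sin θ * sin (b * θ) / (1 - cos θ) * exp (-(s * (1 - cos θ))) ∂ν := by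
    rw [← integral_const_mul, setIntegral_congr_fun measurableSet_Ioi
      (fun t ht => hrep b (hs.trans ht)), integral_const_mul,
      integral_Ioi_integral_mul_exp_neg (by fun_prop) (by fun_prop) hpos
        (ae_of_all _ (abs_sin_mul_sin_natCast_mul_le b)) hs.le]
  set g : ℝ × ℝ → ℝ := fun x =>
    sin x.1 * sin (b * x.1) / (1 - cos x.1) * (sin x.2 * sin (a * x.2)) with hg
  set u : ℝ × ℝ → ℝ := fun x => (1 - cos x.2) + (1 - cos x.1) with hu
  have hgm : Measurable g := by fun_prop
  have hum : Measurable u := by fun_prop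
  have hpos₁ : ∀ᵐ x ∂ν.prod ν, 0 < 1 - cos x.1 := Measure.quasiMeasurePreserving_fst.ae hpos
  have hupos : ∀ᵐ x ∂ν.prod ν, 0 < u x := hpos₁.mono fun x hx =>
    add_pos_of_nonneg_of_pos (sub_nonneg.2 (cos_le_one _)) hx
  have hgu : ∀ᵐ x ∂ν.prod ν, |g x| ≤ 2 * b * (2 * a) * u x := hpos₁.mono fun x hx => by
    rw [hg, hu, abs_mul, abs_div, abs_of_pos hx, mul_assoc (2 * (b : ℝ))]
    refine mul_le_mul ((div_le_iff₀ hx).2 (abs_sin_mul_sin_natCast_mul_le b x.1))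
      ((abs_sin_mul_sin_natCast_mul_le a x.2).trans ?_) (abs_nonneg _) (by positivity)
    gcongr
    exact le_add_of_nonneg_right hx.le
  have hint : Integrable (fun x => g x / u x) (ν.prod ν) := by
    refine Integrable.of_bound (hgm.div hum).aestronglyMeasurable (2 * b * (2 * a)) ?_
    filter_upwards [hupos, hgu] with x hx hgx
    rwa [norm_div, norm_eq_abs, norm_of_nonneg hx.le, div_le_iff₀ hx]
  calc Pfirst a b = ∫ s in Set.Ioi (0 : ℝ), (a * (exp (-s) * besselI a s / s)) *
        (b * ∫ t in Set.Ioi s, exp (-t) * besselI b t / t) := by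
        rw [Pfirst, ← integral_const_mul]
        congr with s
        ring
    _ = ∫ s in Set.Ioi (0 : ℝ), 1 / π ^ 2 * ∫ x, g x * exp (-(s * u x)) ∂ν.prod ν := by
        refine setIntegral_congr_fun measurableSet_Ioi fun s hs => ?_
        rw [hrep a hs, htail hs, mul_mul_mul_comm, mul_comm (∫ θ, _ ∂ν), ← integral_prod_mul]
        congr 1
        · field_simp
        · congr with x
          rw [hg, hu, show -(s * (1 - cos x.2 + (1 - cos x.1))) =
            -(s * (1 - cos x.1)) + -(s * (1 - cos x.2)) by ring, exp_add]
          ring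
    _ = 1 / π ^ 2 * ∫ x, g x / u x ∂ν.prod ν := by
        rw [integral_const_mul, integral_Ioi_integral_mul_exp_neg hgm hum hupos hgu le_rfl]
        simp
    _ = _ := by
        rw [integral_prod _ hint, intervalIntegral.integral_of_le hπ]
        congr with θ₂
        rw [intervalIntegral.integral_of_le hπ, ← integral_const_mul]
        congr with θ₁
        rw [hg, hu, mul_div_assoc]
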